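/- arXiv:2603.05739 — 3 statements merged into one kernel-verified Lean document; each statement's English description precedes it below -/
import Mathlib

section
/- Let Y be a measurable space, π_ref a probability measure on Y, and r̂ : Y → ℝ measurable. Fix λ ∈ ℝ, let A_λ = {y : r̂(y) ≥ λ}, and suppose p_λ = π_ref(A_λ) > 0. Let π̃_λ = π_ref(· | A_λ). Then R^{r̂}(π̃_λ) = 1 − p_λ/2. -/
open MeasureTheory ENNReal

noncomputable section

section Defs

variable {Y : Type*} [MeasurableSpace Y]

/-- Pairwise comparison outcome `φ_r(y,y')`. -/
def phi (r : Y → ℝ) (y y' : Y) : ℝ :=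
  (if r y' < r y then 1 else 0) + (1 / 2) * (if r y = r y' then 1 else 0)

/-- Win-rate of `π` against comparison measure `q` under reward `r`. -/
def winRateQ (q : Measure Y) (r : Y → ℝ) (π : Measure Y) : ℝ :=
  ∫ y, ∫ y', phi r y y' ∂q ∂π

/-- Win-rate of `π` against `πref` under reward `r`. -/
def winRate (πref : Measure Y) (r : Y → ℝ) (π : Measure Y) : ℝ :=
  winRateQ πref r π

/-- Pairwise win-rate error of `rhat` w.r.t. true reward `rstar` under `πref`. -/
def epw (πref : Measure Y) (rhat rstar : Y → ℝ) : ℝ :=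
  ∫ y, ∫ y', |phi rhat y y' - phi rstar y y'| ∂πref ∂πref

/-- `E_M` divergence. -/
def EMdiv (M : ℝ) (ν μ : Measure Y) : ℝ :=
  ∫ y, max ((ν.rnDeriv μ y).toReal - M) 0 ∂μ

/-- Best-of-N selection map: returns `ys i` for the least index `i` attaining the
maximum of `rhat` over the batch. -/
def bonSelect (rhat : Y → ℝ) (N : ℕ) (hN : 0 < N) (ys : Fin N → Y) : Y :=
  ys ((Finset.univ.filter fun i => ∀ j, rhat (ys j) ≤ rhat (ys i)).min'
    (by
      obtain ⟨i, -, hi⟩ :=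
        Finset.exists_max_image (Finset.univ : Finset (Fin N)) (fun i => rhat (ys i))
          ⟨⟨0, hN⟩, Finset.mem_univ _⟩
      exact ⟨i, Finset.mem_filter.mpr ⟨Finset.mem_univ _, fun j => hi j (Finset.mem_univ _)⟩⟩))

/-- The Best-of-N policy: pushforward of `πref^{⊗N}` under the selection map. -/
def bonPolicy (πref : Measure Y) (rhat : Y → ℝ) (N : ℕ) (hN : 0 < N) : Measure Y :=
  Measure.map (bonSelect rhat N hN) (Measure.pi fun _ : Fin N => πref)

/-- Uniform distribution on `[0,1]`. -/
def unif01 : Measure ℝ := (volume : Measure ℝ).restrict (Set.Icc 0 1)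

/-- Indices whose tie-broken pair `(rhat (ys i'), vs i')` is lexicographically strictly
above that of `i` (final ties broken by index). -/
def lexAbove (rhat : Y → ℝ) {N : ℕ} (ys : Fin N → Y) (vs : Fin N → ℝ) (i : Fin N) :
    Finset (Fin N) :=
  Finset.univ.filter fun i' =>
    rhat (ys i) < rhat (ys i') ∨
      (rhat (ys i) = rhat (ys i') ∧ (vs i < vs i' ∨ (vs i = vs i' ∧ i' < i)))

/-- The empirical `E_M`-regularized Best-of-N policy: draw `N` i.i.d. samples from `πref`
and independent uniform tie-breakers, and output a uniformly random element among the
top-`k` samples in the lexicographic order on `(rhat (y i), V i)`. -/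
def empPolicy (πref : Measure Y) (rhat : Y → ℝ) (N k : ℕ) : Measure Y :=
  (k : ℝ≥0∞)⁻¹ • ∑ i : Fin N,
    Measure.map (fun ω : (Fin N → Y) × (Fin N → ℝ) => ω.1 i)
      (((Measure.pi fun _ : Fin N => πref).prod (Measure.pi fun _ : Fin N => unif01)).restrict
        {ω : (Fin N → Y) × (Fin N → ℝ) | (lexAbove rhat ω.1 ω.2 i).card < k})

/-- Total variation distance. -/
def TV (μ ν : Measure Y) : ℝ :=
  ⨆ A : {A : Set Y // MeasurableSet A}, |(μ A.1).toReal - (ν A.1).toReal|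

end Defs

theorem phi_meas_aux {Y : Type*} [MeasurableSpace Y] (r : Y → ℝ) (hr : Measurable r) :
    Measurable (fun z : Y × Y => phi r z.1 z.2) := by
  unfold phi
  have h1 : Measurable (fun z : Y × Y => r z.1) := hr.comp measurable_fst
  have h2 : Measurable (fun z : Y × Y => r z.2) := hr.comp measurable_snd
  exact (Measurable.ite (measurableSet_lt h2 h1) measurable_const measurable_const).add
    ((Measurable.ite (measurableSet_eq_fun h1 h2) measurable_const measurable_const).const_mul _)

theorem phi_bound_aux {Y : Type*} (r : Y → ℝ) (y y' : Y) : ‖phi r y y'‖ ≤ 1 := by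
  unfold phi
  rw [Real.norm_eq_abs, abs_le]
  split_ifs <;> constructor <;> first | linarith | norm_num

theorem phi_symm_aux {Y : Type*} (r : Y → ℝ) (y y' : Y) : phi r y y' = 1 - phi r y' y := by
  unfold phi
  rcases lt_trichotomy (r y) (r y') with h | h | h
  · simp [h, h.not_gt, h.ne, h.ne']
  · simp [h]; norm_num
  · simp [h, h.not_gt, h.ne, h.ne']

theorem phi_int_aux {Y : Type*} [MeasurableSpace Y] (r : Y → ℝ) (hr : Measurable r)
    (μ : Measure Y) [IsFiniteMeasure μ] (y : Y) : Integrable (fun y' => phi r y y') μ :=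
  Integrable.of_bound ((phi_meas_aux r hr).comp measurable_prodMk_left).aestronglyMeasurable 1
    (Filter.Eventually.of_forall fun _ => phi_bound_aux r _ _)

theorem phi_int2_aux {Y : Type*} [MeasurableSpace Y] (r : Y → ℝ) (hr : Measurable r)
    (μ : Measure Y) [IsFiniteMeasure μ] :
    Integrable (fun z : Y × Y => phi r z.1 z.2) (μ.prod μ) :=
  Integrable.of_bound (phi_meas_aux r hr).aestronglyMeasurable 1
    (Filter.Eventually.of_forall fun _ => phi_bound_aux r _ _)

theorem phi_half_aux {Y : Type*} [MeasurableSpace Y] (r : Y → ℝ) (hr : Measurable r)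
    (μ : Measure Y) [IsFiniteMeasure μ] :
    ∫ y, ∫ y', phi r y y' ∂μ ∂μ = μ.real Set.univ ^ 2 / 2 := by
  have h2 := phi_int2_aux r hr μ
  have hs : ∫ y, ∫ y', phi r y y' ∂μ ∂μ = ∫ y, ∫ y', phi r y' y ∂μ ∂μ :=
    integral_integral_swap h2
  have hi : Integrable (fun y => ∫ y', phi r y y' ∂μ) μ := h2.integral_prod_left
  have h3 : ∀ y, ∫ y', phi r y' y ∂μ = μ.real Set.univ - ∫ y', phi r y y' ∂μ := by
    intro y
    simp_rw [fun y' => phi_symm_aux r y' y]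
    rw [integral_sub (integrable_const _) (phi_int_aux r hr μ y)]
    simp
  simp_rw [h3] at hs
  rw [integral_sub (integrable_const _) hi] at hs
  simp only [integral_const, smul_eq_mul] at hs
  linarith

/-- **Win-rate of a threshold policy.** If `A_λ = {r̂ ≥ λ}` has `p_λ = πref(A_λ) > 0`,
then the conditional policy `π̃_λ = πref(·|A_λ)` satisfies `R^{r̂}(π̃_λ) = 1 − p_λ/2`. -/
theorem stmt_16 {Y : Type*} [MeasurableSpace Y]
    (πref : Measure Y) [IsProbabilityMeasure πref]
    (rhat : Y → ℝ) (hmeas : Measurable rhat) (lam : ℝ)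
    (hpos : 0 < πref {y | lam ≤ rhat y}) :
    winRate πref rhat
        ((πref {y | lam ≤ rhat y})⁻¹ • πref.restrict {y | lam ≤ rhat y}) =
      1 - (πref {y | lam ≤ rhat y}).toReal / 2 := by
  set A : Set Y := {y | lam ≤ rhat y} with hA
  have hAm : MeasurableSet A := measurableSet_le measurable_const hmeas
  have hp : 0 < πref.real A := ENNReal.toReal_pos hpos.ne' (measure_ne_top _ _)
  have key : ∀ y ∈ A, ∫ y', phi rhat y y' ∂πref =
      ∫ y', phi rhat y y' ∂(πref.restrict A) + (1 - πref.real A) := by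
    intro y hy
    rw [← integral_add_compl hAm (phi_int_aux rhat hmeas πref y)]
    congr 1
    have : ∫ y' in Aᶜ, phi rhat y y' ∂πref = ∫ y' in Aᶜ, (1 : ℝ) ∂πref := by
      refine setIntegral_congr_fun hAm.compl fun y' hy' => ?_
      have h : rhat y' < rhat y := lt_of_lt_of_le (not_le.mp hy') hy
      simp [phi, h, h.ne']
    rw [this]
    simp [measureReal_compl hAm]
  have hi : Integrable (fun y => ∫ y', phi rhat y y' ∂(πref.restrict A)) (πref.restrict A) :=
    (phi_int2_aux rhat hmeas (πref.restrict A)).integral_prod_left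
  unfold winRate winRateQ
  rw [integral_smul_measure, setIntegral_congr_fun hAm key,
    integral_add hi (integrable_const _), phi_half_aux rhat hmeas]
  simp only [integral_const, smul_eq_mul, measureReal_restrict_apply_univ, ENNReal.toReal_inv]
  change (πref.real A)⁻¹ * _ = 1 - πref.real A / 2
  field_simp
  ring
end
end

section
/- Let Y be a measurable space, π_ref and q probability measures on Y with q ≪ π_ref and dq/dπ_ref ≤ L π_ref-almost everywhere for some L ≥ 1, and let r⋆, r̂ : Y → ℝ be measurable reward functions. Then for every probability measure π on Y with π ≪ π_ref and every real M ≥ 1, |R_q^{r⋆}(π) − R_q^{r̂}(π)| ≤ L·( M·ε_pw(r̂) + E_M(π ‖ π_ref) ). -/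
open MeasureTheory ENNReal

noncomputable section

theorem phi_meas {Y : Type*} [MeasurableSpace Y] (r : Y → ℝ) (hr : Measurable r) :
    Measurable (fun p : Y × Y => phi r p.1 p.2) := by
  unfold phi
  have h1 : Measurable (fun p : Y × Y => r p.1) := hr.comp measurable_fst
  have h2 : Measurable (fun p : Y × Y => r p.2) := hr.comp measurable_snd
  exact (Measurable.ite (measurableSet_lt h2 h1) measurable_const measurable_const).add
    ((Measurable.ite (measurableSet_eq_fun h1 h2) measurable_const measurable_const).const_mul _)

theorem phi_nonneg {Y : Type*} (r : Y → ℝ) (y y' : Y) : 0 ≤ phi r y y' := by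
  unfold phi
  split_ifs <;> norm_num

theorem phi_le_one {Y : Type*} (r : Y → ℝ) (y y' : Y) : phi r y y' ≤ 1 := by
  unfold phi
  split_ifs <;> first | (exfalso; linarith) | norm_num

theorem integrable_of_bdd {Y : Type*} [MeasurableSpace Y] (μ : Measure Y) [IsProbabilityMeasure μ]
    (f : Y → ℝ) (hf : Measurable f) (hb : ∀ y, |f y| ≤ 1) : Integrable f μ :=
  Integrable.of_bound hf.aestronglyMeasurable 1 (Filter.Eventually.of_forall hb)

theorem abs_int_le_one {Y : Type*} [MeasurableSpace Y] (μ : Measure Y) [IsProbabilityMeasure μ]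
    (f : Y → ℝ) (hb : ∀ y, |f y| ≤ 1) : |∫ y, f y ∂μ| ≤ 1 := by
  have := norm_integral_le_of_norm_le_const (μ := μ) (f := f) (C := 1)
    (Filter.Eventually.of_forall hb)
  simpa using this

theorem meas_int {Y : Type*} [MeasurableSpace Y] (μ : Measure Y) [IsProbabilityMeasure μ]
    (F : Y × Y → ℝ) (hF : Measurable F) : Measurable (fun y => ∫ y', F (y, y') ∂μ) :=
  (hF.stronglyMeasurable.integral_prod_right').measurable

/-- **Win-rate transfer lemma against an arbitrary comparison measure `q`.** If `q ≪ πref`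
with density ratio bounded by `L ≥ 1` `πref`-a.e., then for every `π ≪ πref` and `M ≥ 1`,
`|R_q^{r⋆}(π) − R_q^{r̂}(π)| ≤ L (M ε_pw(r̂) + E_M(π ‖ πref))`. -/
theorem stmt_18 {Y : Type*} [MeasurableSpace Y]
    (πref q : Measure Y) [IsProbabilityMeasure πref] [IsProbabilityMeasure q]
    (hq : q ≪ πref) (L : ℝ) (hL : 1 ≤ L)
    (hLbd : ∀ᵐ y ∂πref, (q.rnDeriv πref y).toReal ≤ L)
    (rstar rhat : Y → ℝ) (hrstar : Measurable rstar) (hrhat : Measurable rhat)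
    (π : Measure Y) [IsProbabilityMeasure π] (hac : π ≪ πref)
    (M : ℝ) (hM : 1 ≤ M) :
    |winRateQ q rstar π - winRateQ q rhat π| ≤
      L * (M * epw πref rhat rstar + EMdiv M π πref) := by
  have ms := phi_meas rstar hrstar
  have mh := phi_meas rhat hrhat
  have mD : Measurable (fun p : Y × Y => |phi rhat p.1 p.2 - phi rstar p.1 p.2|) :=
    (mh.sub ms).abs
  have bs : ∀ y y', |phi rstar y y'| ≤ 1 := fun y y' => by
    rw [abs_of_nonneg (phi_nonneg _ _ _)]; exact phi_le_one _ _ _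
  have bh : ∀ y y', |phi rhat y y'| ≤ 1 := fun y y' => by
    rw [abs_of_nonneg (phi_nonneg _ _ _)]; exact phi_le_one _ _ _
  have bD : ∀ y y', |(|phi rhat y y' - phi rstar y y'|)| ≤ 1 := fun y y' => by
    rw [abs_abs, abs_le]
    have := phi_nonneg rhat y y'
    have := phi_nonneg rstar y y'
    have := phi_le_one rhat y y'
    have := phi_le_one rstar y y'
    constructor <;> linarith
  have sec : ∀ (F : Y × Y → ℝ), Measurable F → ∀ y, Measurable (fun y' => F (y, y')) :=
    fun F hF y => hF.comp measurable_prodMk_left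
  set g : Y → ℝ := fun y => ∫ y', |phi rhat y y' - phi rstar y y'| ∂πref with hg
  have mg : Measurable g := meas_int πref _ mD
  have g0 : ∀ y, 0 ≤ g y := fun y => integral_nonneg fun _ => abs_nonneg _
  have bg : ∀ y, |g y| ≤ 1 := fun y => abs_int_le_one πref _ (bD y)
  have g1 : ∀ y, g y ≤ 1 := fun y => (le_abs_self _).trans (bg y)
  have key : ∀ y, ‖(∫ y', phi rstar y y' ∂q) - ∫ y', phi rhat y y' ∂q‖ ≤ L * g y := by
    intro y
    rw [← integral_sub (integrable_of_bdd q _ (sec _ ms y) (bs y))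
      (integrable_of_bdd q _ (sec _ mh y) (bh y))]
    refine (norm_integral_le_integral_norm _).trans ?_
    have e : (∫ y', ‖phi rstar y y' - phi rhat y y'‖ ∂q)
        = ∫ y', |phi rhat y y' - phi rstar y y'| ∂q := by
      congr 1; ext y'; rw [Real.norm_eq_abs, abs_sub_comm]
    rw [e, ← integral_rnDeriv_smul hq, hg, ← integral_const_mul]
    refine integral_mono_of_nonneg ?_ ?_ ?_
    · exact Filter.Eventually.of_forall fun y' => mul_nonneg ENNReal.toReal_nonneg (abs_nonneg _)
    · exact (integrable_of_bdd πref _ (sec _ mD y) (bD y)).const_mul L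
    · filter_upwards [hLbd] with y' h
      exact mul_le_mul_of_nonneg_right h (abs_nonneg _)
  have step1 : |winRateQ q rstar π - winRateQ q rhat π| ≤ L * ∫ y, g y ∂π := by
    unfold winRateQ
    rw [← integral_sub
      (integrable_of_bdd π _ (meas_int q _ ms) fun y => abs_int_le_one q _ (bs y))
      (integrable_of_bdd π _ (meas_int q _ mh) fun y => abs_int_le_one q _ (bh y)),
      ← integral_const_mul]
    exact norm_integral_le_of_norm_le ((integrable_of_bdd π g mg bg).const_mul L)
      (Filter.Eventually.of_forall key)
  refine step1.trans (mul_le_mul_of_nonneg_left ?_ (by linarith))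
  have i1 : Integrable (fun y => M * g y) πref := (integrable_of_bdd πref g mg bg).const_mul M
  have i2 : Integrable (fun y => max ((π.rnDeriv πref y).toReal - M) 0) πref :=
    (Measure.integrable_toReal_rnDeriv.sub (integrable_const M)).sup (integrable_const 0)
  have e : M * epw πref rhat rstar + EMdiv M π πref
      = ∫ y, (M * g y + max ((π.rnDeriv πref y).toReal - M) 0) ∂πref := by
    rw [integral_add i1 i2, integral_const_mul]; rfl
  rw [e, ← integral_rnDeriv_smul hac]
  refine integral_mono_of_nonneg ?_ (i1.add i2) ?_
  · exact Filter.Eventually.of_forall fun y => mul_nonneg ENNReal.toReal_nonneg (g0 y)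
  · refine Filter.Eventually.of_forall fun y => ?_
    have a := le_max_left ((π.rnDeriv πref y).toReal - M) 0
    have b := le_max_right ((π.rnDeriv πref y).toReal - M) 0
    simp only [smul_eq_mul]
    nlinarith [mul_le_mul_of_nonneg_right a (g0 y), mul_le_mul_of_nonneg_left (g1 y) b]
end
end

section
/- Let Y be a measurable space, π_ref a probability measure on Y, r̂ : Y → ℝ measurable, and N ≥ 1 an integer. Then the Best-of-N policy π_BoN satisfies π_BoN(A) ≤ N·π_ref(A) for every measurable set A ⊆ Y. Consequently π_BoN ≪ π_ref, the density ratio satisfies dπ_BoN/dπ_ref ≤ N π_ref-almost everywhere, and E_N(π_BoN ‖ π_ref) = 0. -/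
open MeasureTheory ENNReal

noncomputable section

/-- **Density-ratio bound for Best-of-N.** The Best-of-N policy satisfies
`π_BoN(A) ≤ N·πref(A)` for every measurable `A`; consequently `π_BoN ≪ πref`, its
density ratio is at most `N` `πref`-a.e., and `E_N(π_BoN ‖ πref) = 0`. -/
theorem stmt_19 {Y : Type*} [MeasurableSpace Y]
    (πref : Measure Y) [IsProbabilityMeasure πref]
    (rhat : Y → ℝ) (hmeas : Measurable rhat)
    (N : ℕ) (hN : 0 < N) :
    (∀ A : Set Y, MeasurableSet A →
      bonPolicy πref rhat N hN A ≤ (N : ℝ≥0∞) * πref A) ∧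
    bonPolicy πref rhat N hN ≪ πref ∧
    (∀ᵐ y ∂πref, ((bonPolicy πref rhat N hN).rnDeriv πref y).toReal ≤ (N : ℝ)) ∧
    EMdiv (N : ℝ) (bonPolicy πref rhat N hN) πref = 0 := by
  have hA : ∀ A : Set Y, MeasurableSet A →
      bonPolicy πref rhat N hN A ≤ (N : ℝ≥0∞) * πref A := by
    intro A hA
    unfold bonPolicy
    by_cases hm : AEMeasurable (bonSelect rhat N hN) (Measure.pi fun _ : Fin N => πref)
    · rw [Measure.map_apply_of_aemeasurable hm hA]
      have hsub : bonSelect rhat N hN ⁻¹' A ⊆ ⋃ i : Fin N, (Function.eval i) ⁻¹' A := by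
        intro ys hys
        exact Set.mem_iUnion.mpr ⟨_, hys⟩
      refine (measure_mono hsub).trans ((measure_iUnion_fintype_le _ _).trans ?_)
      have h : ∀ i : Fin N, (Measure.pi fun _ : Fin N => πref) (Function.eval i ⁻¹' A) = πref A :=
        fun i => (measurePreserving_eval (fun _ : Fin N => πref) i).measure_preimage
          hA.nullMeasurableSet
      simp [h]
    · rw [Measure.map_of_not_aemeasurable hm]
      simp
  have hac : ∀ᵐ y ∂πref, (bonPolicy πref rhat N hN).rnDeriv πref y ≤ (N : ℝ≥0∞) := by
    refine ae_le_of_forall_setLIntegral_le_of_sigmaFinite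
      (Measure.measurable_rnDeriv _ _) ?_
    intro s hs _
    refine (Measure.setLIntegral_rnDeriv_le s).trans ?_
    simpa using hA s hs
  have hre : ∀ᵐ y ∂πref, ((bonPolicy πref rhat N hN).rnDeriv πref y).toReal ≤ (N : ℝ) := by
    filter_upwards [hac] with y hy
    simpa using ENNReal.toReal_mono (ENNReal.natCast_ne_top N) hy
  refine ⟨hA, Measure.AbsolutelyContinuous.mk fun s hs h0 => ?_, hre, ?_⟩
  · simpa [h0] using hA s hs
  · unfold EMdiv
    refine integral_eq_zero_of_ae ?_
    filter_upwards [hre] with y hy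
    simpa using hy
end
end
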